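/- Let β⃗ be sub-critical. There exists a constant δ > 0 such that the following holds for all sufficiently large n. For any configurations y ≤ z (coordinatewise) with y, z ∈ T_δ, there is an M×M matrix K = K(n,y,z) with nonnegative entries such that ‖K‖_1 < 1 − δ/M (maximal column ℓ¹-sum) and, under the grand coupling of the Glauber chains Z^y(t), Z^z(t), the vector r(t) with entries r(t)_e = ℙ(Z^y_e(t) ≠ Z^z_e(t)) satisfies the pointwise inequality r(1) ≤ K r(0). -/

import Mathlib

open Finset MeasureTheory Filter
open scoped ENNReal NNReal

namespace ERGM

/-- The set of edges of the complete graph on `Fin n`: non-diagonal unordered pairs. -/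
abbrev EdgeSet (n : ℕ) : Type := {p : Sym2 (Fin n) // ¬ p.IsDiag}

/-- A configuration (graph on `n` vertices): an assignment of `true/false` to each edge. -/
abbrev Config (n : ℕ) : Type := EdgeSet n → Bool

/-- The value of the configuration `x` on the (unordered) pair `{i,j}`; `false` for `i = j`. -/
noncomputable def edgeVal {n : ℕ} (x : Config n) (i j : Fin n) : Bool :=
  if h : (s(i, j) : Sym2 (Fin n)).IsDiag then false else x ⟨s(i, j), h⟩

/-- Real-valued indicator of presence of the edge `{i,j}` in `x`. -/
noncomputable def edgeInd {n : ℕ} (x : Config n) (i j : Fin n) : ℝ :=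
  if edgeVal x i j = true then 1 else 0

open scoped Classical in
/-- Subgraph counting number `N_G(x)`: the number of copies of `G` in `x` (times the
number of automorphisms), i.e. the sum over injective `ψ` of the product of edge
indicators (each edge indicator is idempotent, so counting ordered adjacent pairs
yields the same value as counting edges). -/
noncomputable def NG {n m : ℕ} (G : SimpleGraph (Fin m)) (x : Config n) : ℝ :=
  ∑ ψ : Fin m ↪ Fin n, ∏ a : Fin m, ∏ b : Fin m,
    if G.Adj a b then edgeInd x (ψ a) (ψ b) else 1

/-- The Hamiltonian `H(x) = Σ_i β_i N_{G_i}(x) / n^{|V_i|-2}`. -/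
noncomputable def Hamiltonian {n s : ℕ} (V : Fin s → ℕ)
    (G : ∀ i, SimpleGraph (Fin (V i))) (β : Fin s → ℝ) (x : Config n) : ℝ :=
  ∑ i, β i * NG (G i) x / (n : ℝ) ^ (V i - 2)

/-- The ERGM probability mass function `π(x) ∝ exp(H(x))`. -/
noncomputable def ergmProb {n s : ℕ} (V : Fin s → ℕ)
    (G : ∀ i, SimpleGraph (Fin (V i))) (β : Fin s → ℝ) (x : Config n) : ℝ :=
  Real.exp (Hamiltonian V G β x) / ∑ y : Config n, Real.exp (Hamiltonian V G β y)

/-- Expectation of `f` with respect to the mass function `w`. -/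
noncomputable def expect {n : ℕ} (w : Config n → ℝ) (f : Config n → ℝ) : ℝ :=
  ∑ x : Config n, w x * f x

open scoped Classical in
/-- Probability of the event `A` with respect to the mass function `w`. -/
noncomputable def prob {n : ℕ} (w : Config n → ℝ) (A : Config n → Prop) : ℝ :=
  ∑ x : Config n, if A x then w x else 0

/-- The number of edges `|E(G)|` of a finite graph. -/
noncomputable def numEdges {m : ℕ} (G : SimpleGraph (Fin m)) : ℕ := G.edgeSet.ncard

/-- `Ψ_β(p) = Σ_i 2 β_i |E_i| p^{|E_i|-1}`. -/
noncomputable def Psi {s : ℕ} (V : Fin s → ℕ) (G : ∀ i, SimpleGraph (Fin (V i)))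
    (β : Fin s → ℝ) (p : ℝ) : ℝ :=
  ∑ i, 2 * β i * (numEdges (G i) : ℝ) * p ^ (numEdges (G i) - 1)

/-- `Φ(u) = e^u / (1 + e^u)`. -/
noncomputable def Phi (u : ℝ) : ℝ := Real.exp u / (1 + Real.exp u)

/-- `φ_β(p) = Φ(Ψ_β(p))`. -/
noncomputable def phiFn {s : ℕ} (V : Fin s → ℕ) (G : ∀ i, SimpleGraph (Fin (V i)))
    (β : Fin s → ℝ) : ℝ → ℝ := fun p => Phi (Psi V G β p)

/-- `β` is sub-critical (high temperature) with fixed point `p`: `p` is the unique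
solution of `φ_β(p) = p` and it satisfies `φ_β'(p) < 1`. -/
def Subcritical {s : ℕ} (V : Fin s → ℕ) (G : ∀ i, SimpleGraph (Fin (V i)))
    (β : Fin s → ℝ) (p : ℝ) : Prop :=
  phiFn V G β p = p ∧ (∀ q : ℝ, phiFn V G β q = q → q = p) ∧
    deriv (phiFn V G β) p < 1

/-- The discrete derivative `∂_e H(x) = H(x_{e+}) - H(x_{e-})`. -/
noncomputable def dHam {n s : ℕ} (V : Fin s → ℕ) (G : ∀ i, SimpleGraph (Fin (V i)))
    (β : Fin s → ℝ) (e : EdgeSet n) (x : Config n) : ℝ :=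
  Hamiltonian V G β (Function.update x e true) - Hamiltonian V G β (Function.update x e false)

/-- Real-valued indicator `X_e` of presence of edge `e`. -/
noncomputable def edgeX {n : ℕ} (e : EdgeSet n) (x : Config n) : ℝ := if x e = true then 1 else 0

/-- Two edges of `K_n` share a vertex. -/
def ShareVertex {n : ℕ} (e f : EdgeSet n) : Prop := ∃ v : Fin n, v ∈ e.1 ∧ v ∈ f.1


instance (n : ℕ) : MeasurableSpace (EdgeSet n) := ⊤

open scoped Classical in
/-- One step of the grand coupling driven by the seed `ω = (I, U)`: the coordinate `I`
of `x` is set to `1` iff `U ≤ Φ(∂_I H(x))`. -/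
noncomputable def gcStep {n s : ℕ} (V : Fin s → ℕ) (G : ∀ i, SimpleGraph (Fin (V i)))
    (β : Fin s → ℝ) (ω : EdgeSet n × ℝ) (x : Config n) : Config n :=
  Function.update x ω.1 (if ω.2 ≤ Phi (dHam V G β ω.1 x) then true else false)

/-- `t` steps of the grand coupling driven by the seeds `ω : Fin t → EdgeSet n × ℝ`. -/
noncomputable def gcRun {n s : ℕ} (V : Fin s → ℕ) (G : ∀ i, SimpleGraph (Fin (V i)))
    (β : Fin s → ℝ) : (t : ℕ) → (Fin t → EdgeSet n × ℝ) → Config n → Config n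
  | 0, _, x => x
  | t + 1, ω, x =>
      gcStep V G β (ω (Fin.last t)) (gcRun V G β t (fun i => ω i.castSucc) x)

/-- The law of one seed of the grand coupling: a uniformly chosen edge `I` together
with an independent uniform variable `U` on `[0,1]`. -/
noncomputable def seed (n : ℕ) : Measure (EdgeSet n × ℝ) :=
  ((Fintype.card (EdgeSet n) : ℝ≥0∞)⁻¹ • (Measure.count : Measure (EdgeSet n))).prod
    (volume.restrict (Set.Ioc (0 : ℝ) 1))

/-- The law of `t` independent seeds of the grand coupling. -/
noncomputable def seeds (n t : ℕ) : Measure (Fin t → EdgeSet n × ℝ) :=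
  Measure.pi fun _ => seed n

open scoped Classical in
/-- `N_G(x,e)`: the number of injective `ψ` such that every edge of `G` maps to an edge
present in `x_{e+}` and some edge of `G` maps onto `e`. -/
noncomputable def NGe {n m : ℕ} (G : SimpleGraph (Fin m)) (x : Config n) (e : EdgeSet n) : ℝ :=
  ∑ ψ : Fin m ↪ Fin n,
    if (∀ a b : Fin m, G.Adj a b → edgeVal (Function.update x e true) (ψ a) (ψ b) = true) ∧
       (∃ a b : Fin m, G.Adj a b ∧ (s(ψ a, ψ b) : Sym2 (Fin n)) = e.1) then 1 else 0

/-- The normalized subgraph counting number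
`r_G(x,e) = (N_G(x,e) / (2|E(G)| n^{|V(G)|-2}))^{1/(|E(G)|-1)}`. -/
noncomputable def rG {n m : ℕ} (G : SimpleGraph (Fin m)) (x : Config n) (e : EdgeSet n) : ℝ :=
  (NGe G x e / (2 * (numEdges G : ℝ) * (n : ℝ) ^ (m - 2))) ^
    ((1 : ℝ) / ((numEdges G : ℝ) - 1))

/-- Membership in the set `T_δ`: all normalized subgraph counting numbers `r_G(x,e)`,
over (nondegenerate) graphs `G` with at most `a` vertices and edges `e` of `K_n`,
lie in `(p* - δ, p* + δ)`. -/
def memT {n : ℕ} (a : ℕ) (pstar δ : ℝ) (x : Config n) : Prop :=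
  ∀ m : ℕ, m ≤ a → ∀ G : SimpleGraph (Fin m), 2 ≤ numEdges G →
    ∀ e : EdgeSet n, pstar - δ < rG G x e ∧ rG G x e < pstar + δ

open scoped Topology

/-- The embedding `ψ` maps some edge of `G` onto `e`. -/
def HitsEdge {n m : ℕ} (G : SimpleGraph (Fin m)) (ψ : Fin m ↪ Fin n) (e : EdgeSet n) : Prop :=
  ∃ d ∈ G.edgeSet, d.map ψ = e.1

/-- The embedding `ψ` maps all edges of `G` to edges present in `x`. -/
def MapsInto {n m : ℕ} (G : SimpleGraph (Fin m)) (x : Config n) (ψ : Fin m ↪ Fin n) : Prop :=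
  ∀ d ∈ G.edgeSet, ∀ f : EdgeSet n, d.map ψ = f.1 → x f = true

lemma hitsEdge_iff {n m : ℕ} (G : SimpleGraph (Fin m)) (ψ : Fin m ↪ Fin n) (e : EdgeSet n) :
    HitsEdge G ψ e ↔ ∃ a b : Fin m, G.Adj a b ∧ (s(ψ a, ψ b) : Sym2 (Fin n)) = e.1 := by
  constructor
  · rintro ⟨d, hd, hde⟩
    induction d using Sym2.ind with
    | _ a b => exact ⟨a, b, by simpa using hd, by simpa using hde⟩
  · rintro ⟨a, b, h, he⟩
    exact ⟨s(a, b), by simpa using h, by simpa using he⟩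

lemma mapsInto_iff {n m : ℕ} (G : SimpleGraph (Fin m)) (x : Config n) (ψ : Fin m ↪ Fin n) :
    MapsInto G x ψ ↔ ∀ a b : Fin m, G.Adj a b → edgeVal x (ψ a) (ψ b) = true := by
  constructor
  · intro h a b hab
    have hd : ¬ (s(ψ a, ψ b) : Sym2 (Fin n)).IsDiag := by simpa using hab.ne
    rw [edgeVal, dif_neg hd]
    exact h s(a, b) (by simpa using hab) _ (by simp)
  · intro h d hd f hf
    induction d using Sym2.ind with
    | _ a b =>
      have h1 := h a b (by simpa using hd)
      have hf' : s(ψ a, ψ b) = f.1 := by simpa using hf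
      have hd : ¬ (s(ψ a, ψ b) : Sym2 (Fin n)).IsDiag := hf' ▸ f.2
      rw [edgeVal, dif_neg hd] at h1
      rw [← h1]
      congr 1
      exact Subtype.ext hf'.symm

lemma exists_edgeSet_eq_map {n m : ℕ} {G : SimpleGraph (Fin m)} (ψ : Fin m ↪ Fin n)
    {d : Sym2 (Fin m)} (hd : d ∈ G.edgeSet) : ∃ f : EdgeSet n, d.map ψ = f.1 := by
  refine ⟨⟨d.map ψ, ?_⟩, rfl⟩
  rw [Sym2.isDiag_map ψ.injective]
  exact G.not_isDiag_of_mem_edgeSet hd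

open scoped Classical in
lemma NGe_eq {n m : ℕ} (G : SimpleGraph (Fin m)) (x : Config n) (e : EdgeSet n) :
    NGe G x e = ∑ ψ : Fin m ↪ Fin n,
      if MapsInto G (Function.update x e true) ψ ∧ HitsEdge G ψ e then 1 else 0 := by
  unfold NGe
  refine Finset.sum_congr rfl fun ψ _ => ?_
  simp only [mapsInto_iff, hitsEdge_iff]

lemma NGe_nonneg {n m : ℕ} (G : SimpleGraph (Fin m)) (x : Config n) (e : EdgeSet n) :
    0 ≤ NGe G x e := by
  classical
  rw [NGe_eq]
  exact Finset.sum_nonneg fun ψ _ => by split_ifs <;> norm_num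

open scoped Classical in
lemma NG_eq {n m : ℕ} (G : SimpleGraph (Fin m)) (x : Config n) :
    NG G x = ∑ ψ : Fin m ↪ Fin n, if MapsInto G x ψ then 1 else 0 := by
  unfold NG
  refine Finset.sum_congr rfl fun ψ _ => ?_
  split_ifs with h
  · rw [mapsInto_iff] at h
    refine Finset.prod_eq_one fun a _ => Finset.prod_eq_one fun b _ => ?_
    split_ifs with hab
    · simp [edgeInd, h a b hab]
    · rfl
  · rw [mapsInto_iff] at h
    push Not at h
    obtain ⟨a, b, hab, hx⟩ := h
    refine Finset.prod_eq_zero (Finset.mem_univ a) (Finset.prod_eq_zero (Finset.mem_univ b) ?_)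
    simp [hab, edgeInd, hx]

lemma NG_update_sub {n m : ℕ} (G : SimpleGraph (Fin m)) (x : Config n) (e : EdgeSet n) :
    NG G (Function.update x e true) - NG G (Function.update x e false) = NGe G x e := by
  classical
  rw [NG_eq, NG_eq, NGe_eq, ← Finset.sum_sub_distrib]
  refine Finset.sum_congr rfl fun ψ _ => ?_
  by_cases hh : HitsEdge G ψ e
  · have : ¬ MapsInto G (Function.update x e false) ψ := by
      obtain ⟨d, hd, hde⟩ := hh
      intro h
      simpa using h d hd e hde
    simp [hh, this]
  · have : MapsInto G (Function.update x e true) ψ ↔ MapsInto G (Function.update x e false) ψ := by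
      refine forall₂_congr fun d hd => forall₂_congr fun f hf => ?_
      have : f ≠ e := by rintro rfl; exact hh ⟨d, hd, hf⟩
      simp [this]
    simp [hh, this]

lemma dHam_eq {n s : ℕ} (V : Fin s → ℕ) (G : ∀ i, SimpleGraph (Fin (V i)))
    (β : Fin s → ℝ) (e : EdgeSet n) (x : Config n) :
    dHam V G β e x = ∑ i, β i * (NGe (G i) x e / (n : ℝ) ^ (V i - 2)) := by
  unfold dHam Hamiltonian
  rw [← Finset.sum_sub_distrib]
  refine Finset.sum_congr rfl fun i _ => ?_
  rw [← NG_update_sub]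
  ring

lemma update_le_update {n : ℕ} {y z : Config n} (h : ∀ e, y e ≤ z e) (e : EdgeSet n) (f) :
    Function.update y e true f ≤ Function.update z e true f := by
  by_cases hf : f = e
  · subst hf; simp
  · simpa [hf] using h f

lemma MapsInto.mono {n m : ℕ} {G : SimpleGraph (Fin m)} {y z : Config n} (h : ∀ e, y e ≤ z e)
    {ψ : Fin m ↪ Fin n} (hy : MapsInto G y ψ) : MapsInto G z ψ := by
  intro d hd f hf
  have := h f
  rw [hy d hd f hf] at this
  exact top_le_iff.1 this

lemma NGe_mono {n m : ℕ} (G : SimpleGraph (Fin m)) {y z : Config n} (h : ∀ e, y e ≤ z e)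
    (e : EdgeSet n) : NGe G y e ≤ NGe G z e := by
  classical
  rw [NGe_eq, NGe_eq]
  refine Finset.sum_le_sum fun ψ _ => ?_
  have := @MapsInto.mono n m G _ _ (update_le_update h e) ψ
  split_ifs with h1 h2
  · rfl
  · exact absurd ⟨this h1.1, h1.2⟩ h2
  · norm_num
  · rfl

open scoped Classical in
/-- The number of embeddings of `G` into `x` with `e` added which use both `e` and `f`. -/
noncomputable def NGee {n m : ℕ} (G : SimpleGraph (Fin m)) (x : Config n) (e f : EdgeSet n) : ℝ :=
  ∑ ψ : Fin m ↪ Fin n,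
    if MapsInto G (Function.update x e true) ψ ∧ HitsEdge G ψ e ∧ HitsEdge G ψ f then 1 else 0

lemma NGee_nonneg {n m : ℕ} (G : SimpleGraph (Fin m)) (x : Config n) (e f : EdgeSet n) :
    0 ≤ NGee G x e f := by
  classical
  exact Finset.sum_nonneg fun ψ _ => by split_ifs <;> norm_num

open scoped Classical in
lemma NGe_sub_le {n m : ℕ} (G : SimpleGraph (Fin m)) (y z : Config n) (e : EdgeSet n) :
    NGe G z e - NGe G y e ≤
      ∑ f : EdgeSet n, if f ≠ e ∧ y f ≠ z f then NGee G z e f else 0 := by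
  have h1 : ∀ f : EdgeSet n, (if f ≠ e ∧ y f ≠ z f then NGee G z e f else 0) =
      ∑ ψ : Fin m ↪ Fin n, if f ≠ e ∧ y f ≠ z f then
        (if MapsInto G (Function.update z e true) ψ ∧ HitsEdge G ψ e ∧ HitsEdge G ψ f
          then (1 : ℝ) else 0) else 0 := by
    intro f
    split_ifs
    · rfl
    · simp
  rw [Finset.sum_congr rfl fun f _ => h1 f, Finset.sum_comm, NGe_eq, NGe_eq,
    ← Finset.sum_sub_distrib]
  refine Finset.sum_le_sum fun ψ _ => ?_
  have hnn : ∀ f ∈ (Finset.univ : Finset (EdgeSet n)), 0 ≤ if f ≠ e ∧ y f ≠ z f then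
        (if MapsInto G (Function.update z e true) ψ ∧ HitsEdge G ψ e ∧ HitsEdge G ψ f
          then (1 : ℝ) else 0) else 0 := by
    intro f _; split_ifs <;> norm_num
  by_cases hz : MapsInto G (Function.update z e true) ψ ∧ HitsEdge G ψ e
  · by_cases hy : MapsInto G (Function.update y e true) ψ ∧ HitsEdge G ψ e
    · rw [if_pos hz, if_pos hy, sub_self]
      exact Finset.sum_nonneg hnn
    · rw [if_pos hz, if_neg hy]
      have : ¬ MapsInto G (Function.update y e true) ψ := fun h => hy ⟨h, hz.2⟩
      unfold MapsInto at this
      push Not at this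
      obtain ⟨d, hd, f, hf, hyf⟩ := this
      have hzf := hz.1 d hd f hf
      have hfe : f ≠ e := by rintro rfl; simp at hyf
      have hne : y f ≠ z f := by
        rw [Function.update_of_ne hfe] at hyf hzf
        rw [hzf]; exact hyf
      refine le_trans ?_ (Finset.single_le_sum hnn (Finset.mem_univ f))
      rw [if_pos ⟨hfe, hne⟩, if_pos ⟨hz.1, hz.2, d, hd, hf⟩]
      simp
  · rw [if_neg hz]
    refine le_trans ?_ (Finset.sum_nonneg hnn)
    split_ifs <;> norm_num

open scoped Classical in
lemma sum_NGee_le {n m : ℕ} (G : SimpleGraph (Fin m)) (x : Config n) (f : EdgeSet n) :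
    ∑ e : EdgeSet n, (if f ≠ e then NGee G x e f else 0) ≤
      ∑ d ∈ G.edgeFinset, NGe (G.deleteEdges {d}) x f := by
  have h1 : ∀ e : EdgeSet n, (if f ≠ e then NGee G x e f else 0) =
      ∑ ψ : Fin m ↪ Fin n, if f ≠ e then
        (if MapsInto G (Function.update x e true) ψ ∧ HitsEdge G ψ e ∧ HitsEdge G ψ f
          then (1 : ℝ) else 0) else 0 := by
    intro f
    split_ifs
    · rfl
    · simp
  simp only [h1, NGe_eq]
  rw [Finset.sum_comm, Finset.sum_comm (s := G.edgeFinset)]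
  refine Finset.sum_le_sum fun ψ _ => ?_
  simp only [← ite_and]
  rw [Finset.sum_boole, Finset.sum_boole]
  norm_cast
  refine (Finset.card_le_card_of_surjOn (fun d => d.map ψ) (t := Finset.image Subtype.val
    {e : EdgeSet n | f ≠ e ∧ MapsInto G (Function.update x e true) ψ ∧
      HitsEdge G ψ e ∧ HitsEdge G ψ f}) ?_).trans' ?_
  · rintro _ he
    simp only [Finset.coe_image, Finset.coe_filter, Finset.mem_univ, true_and, Set.mem_image,
      Set.mem_ofPred_eq] at he
    obtain ⟨e, ⟨hfe, hm, ⟨d, hd, hde⟩, d', hd', hdf⟩, rfl⟩ := he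
    refine ⟨d, ?_, hde⟩
    simp only [Finset.coe_filter, Set.mem_ofPred_eq, SimpleGraph.mem_edgeFinset]
    refine ⟨hd, ?_, d', ?_, hdf⟩
    · intro d₁ hd₁ g hg
      rw [SimpleGraph.edgeSet_deleteEdges] at hd₁
      have hge : g ≠ e := by
        rintro rfl
        exact hd₁.2 (Sym2.map.injective ψ.injective (hg.trans hde.symm))
      have := hm d₁ hd₁.1 g hg
      rw [Function.update_of_ne hge] at this
      by_cases hgf : g = f
      · subst hgf; simp
      · rwa [Function.update_of_ne hgf]
    · rw [SimpleGraph.edgeSet_deleteEdges]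
      refine ⟨hd', ?_⟩
      rintro rfl
      exact hfe (Subtype.ext (hdf.symm.trans hde))
  · rw [Finset.card_image_of_injective _ Subtype.val_injective]

lemma numEdges_deleteEdges {m : ℕ} (G : SimpleGraph (Fin m)) {d : Sym2 (Fin m)}
    (hd : d ∈ G.edgeSet) : numEdges (G.deleteEdges {d}) = numEdges G - 1 := by
  unfold numEdges
  rw [SimpleGraph.edgeSet_deleteEdges, Set.ncard_sdiff_singleton_of_mem hd]

open scoped Classical in
lemma card_edgeFinset_eq_numEdges {m : ℕ} (G : SimpleGraph (Fin m)) :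
    G.edgeFinset.card = numEdges G := by
  unfold numEdges
  rw [← SimpleGraph.coe_edgeFinset, Set.ncard_coe_finset]

open scoped Classical in
lemma card_embedding_filter_mul {n m : ℕ} {a b : Fin m} (hab : a ≠ b) {v w : Fin n} (hvw : v ≠ w) :
    #{ψ : Fin m ↪ Fin n | ψ a = v ∧ ψ b = w} * (n * (n - 1)) = n.descFactorial m := by
  have hle : ∀ v w v' w' : Fin n, v ≠ w → v' ≠ w' →
      #{ψ : Fin m ↪ Fin n | ψ a = v ∧ ψ b = w} ≤ #{ψ : Fin m ↪ Fin n | ψ a = v' ∧ ψ b = w'} := by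
    intro v w v' w' h h'
    obtain ⟨σ, h1, h2⟩ : ∃ σ : Equiv.Perm (Fin n), σ v = v' ∧ σ w = w' := by
      refine ⟨Equiv.swap (Equiv.swap v v' w) w' * Equiv.swap v v', ?_, ?_⟩
      · rw [Equiv.Perm.mul_apply, Equiv.swap_apply_left, Equiv.swap_apply_of_ne_of_ne _ h']
        intro h3
        have := Equiv.swap_apply_left v v'
        exact h ((Equiv.swap v v').injective (this.trans h3))
      · rw [Equiv.Perm.mul_apply, Equiv.swap_apply_left]
    refine Finset.card_le_card_of_injOn (fun ψ => ψ.trans σ.toEmbedding) ?_ ?_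
    · intro ψ hψ
      simp only [Finset.coe_filter, Finset.mem_univ, true_and, Set.mem_ofPred_eq] at hψ ⊢
      simp [hψ.1, hψ.2, h1, h2]
    · intro ψ _ φ _ h
      ext i
      have := DFunLike.congr_fun h i
      simpa using congrArg Fin.val (σ.injective this)
  have hsum : ∑ q ∈ (Finset.univ : Finset (Fin n)).offDiag,
      #{ψ : Fin m ↪ Fin n | ψ a = q.1 ∧ ψ b = q.2} = n.descFactorial m := by
    have := Finset.card_eq_sum_card_fiberwise (s := (Finset.univ : Finset (Fin m ↪ Fin n)))
      (t := (Finset.univ : Finset (Fin n)).offDiag) (f := fun ψ => (ψ a, ψ b)) (by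
        intro ψ _
        simpa using hab)
    rw [Finset.card_univ, Fintype.card_embedding_eq, Fintype.card_fin, Fintype.card_fin] at this
    rw [this]
    refine Finset.sum_congr rfl fun q _ => ?_
    simp [Prod.ext_iff]
  have hconst : ∀ q ∈ (Finset.univ : Finset (Fin n)).offDiag,
      #{ψ : Fin m ↪ Fin n | ψ a = q.1 ∧ ψ b = q.2} = #{ψ : Fin m ↪ Fin n | ψ a = v ∧ ψ b = w} := by
    intro q hq
    rw [Finset.mem_offDiag] at hq
    exact le_antisymm (hle _ _ _ _ hq.2.2 hvw) (hle _ _ _ _ hvw hq.2.2)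
  rw [← hsum, Finset.sum_const_nat hconst, Finset.offDiag_card, Finset.card_univ, Fintype.card_fin,
    Nat.mul_sub, mul_one, mul_comm]

open scoped Classical in
lemma card_embedding_filter {n m : ℕ} {a b : Fin m} (hab : a ≠ b) {v w : Fin n} (hvw : v ≠ w) :
    #{ψ : Fin m ↪ Fin n | ψ a = v ∧ ψ b = w} = (n - 2).descFactorial (m - 2) := by
  have h := card_embedding_filter_mul hab hvw
  have hn : 2 ≤ n := by
    by_contra hn
    have := v.2; have := w.2
    exact hvw (Fin.ext (by omega))
  have hm : 2 ≤ m := by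
    by_contra hm
    have := a.2; have := b.2
    exact hab (Fin.ext (by omega))
  obtain ⟨n, rfl⟩ := Nat.exists_eq_add_of_le' hn
  obtain ⟨m, rfl⟩ := Nat.exists_eq_add_of_le' hm
  rw [Nat.succ_descFactorial_succ, Nat.succ_descFactorial_succ] at h
  have h' : (0 : ℕ) < (n + 2) * (n + 1) := by positivity
  refine Nat.eq_of_mul_eq_mul_right h' ?_
  simpa [mul_comm, mul_assoc, mul_left_comm] using h

lemma NGe_of_numEdges_eq_one {n m : ℕ} (G : SimpleGraph (Fin m)) (hG : numEdges G = 1)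
    (x : Config n) (e : EdgeSet n) : NGe G x e = 2 * ((n - 2).descFactorial (m - 2) : ℕ) := by
  classical
  obtain ⟨d, hd⟩ := Set.ncard_eq_one.1 hG
  obtain ⟨e, he⟩ := e
  have hdG : d ∈ G.edgeSet := by simp [hd]
  induction d using Sym2.ind with
  | _ a b =>
  induction e using Sym2.ind with
  | _ v w =>
  have hab : a ≠ b := by
    have : G.Adj a b := by simpa using hdG
    exact this.ne
  have hvw : v ≠ w := by simpa using he
  have hiff : ∀ ψ : Fin m ↪ Fin n,
      (MapsInto G (Function.update x ⟨s(v, w), he⟩ true) ψ ∧ HitsEdge G ψ ⟨s(v, w), he⟩) ↔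
        ((ψ a = v ∧ ψ b = w) ∨ (ψ a = w ∧ ψ b = v)) := by
    intro ψ
    simp only [MapsInto, HitsEdge, hd, Set.mem_singleton_iff, forall_eq, exists_eq_left,
      Sym2.map_mk, Sym2.eq_iff]
    refine ⟨fun h => h.2, fun h => ⟨fun f hf => ?_, h⟩⟩
    have : f = ⟨s(v, w), he⟩ := by
      apply Subtype.ext
      rw [← hf]
      exact Sym2.eq_iff.2 h
    simp [this]
  rw [NGe_eq]
  simp only [hiff]
  rw [Finset.sum_boole, Finset.filter_or, Finset.card_union_of_disjoint, card_embedding_filter hab hvw,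
    card_embedding_filter hab hvw.symm]
  · push_cast; ring
  · rw [Finset.disjoint_filter]
    rintro ψ _ ⟨h1, _⟩ ⟨h2, _⟩
    exact hvw (h1.symm.trans h2)

lemma NGe_of_numEdges_eq_zero {n m : ℕ} (G : SimpleGraph (Fin m)) (hG : numEdges G = 0)
    (x : Config n) (e : EdgeSet n) : NGe G x e = 0 := by
  classical
  have : G.edgeSet = ∅ := (Set.ncard_eq_zero (Set.toFinite _)).1 hG
  rw [NGe_eq]
  simp [HitsEdge, this]

lemma rG_pow {n m : ℕ} (G : SimpleGraph (Fin m)) (hG : 2 ≤ numEdges G) (x : Config n)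
    (e : EdgeSet n) :
    2 * (numEdges G : ℝ) * rG G x e ^ (numEdges G - 1) = NGe G x e / (n : ℝ) ^ (m - 2) := by
  have hk : ((numEdges G - 1 : ℕ) : ℝ) = (numEdges G : ℝ) - 1 := by
    rw [Nat.cast_sub (by omega)]; simp
  have hk0 : (numEdges G : ℝ) ≠ 0 := by
    norm_cast; omega
  rw [rG, one_div, ← hk, Real.rpow_inv_natCast_pow _ (by omega)]
  · field_simp
  · have := NGe_nonneg G x e
    positivity

lemma NGe_div_le {n m a : ℕ} {p δ : ℝ} (hδ : 0 < p - δ) {x : Config n} (hx : memT a p δ x)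
    (hm : m ≤ a) (G : SimpleGraph (Fin m)) (e : EdgeSet n) :
    NGe G x e / (n : ℝ) ^ (m - 2) ≤ 2 * (numEdges G : ℝ) * (p + δ) ^ (numEdges G - 1) := by
  rcases Nat.lt_or_ge (numEdges G) 2 with h | h
  · interval_cases hG : numEdges G
    · rw [NGe_of_numEdges_eq_zero G hG]; simp
    · rw [NGe_of_numEdges_eq_one G hG]
      have h1 : (n - 2).descFactorial (m - 2) ≤ n ^ (m - 2) :=
        (Nat.descFactorial_le_pow _ _).trans (Nat.pow_le_pow_left (Nat.sub_le _ _) _)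
      have h2 : (((n - 2).descFactorial (m - 2) : ℕ) : ℝ) ≤ (n : ℝ) ^ (m - 2) := by exact_mod_cast h1
      have := div_le_one_of_le₀ h2 (by positivity)
      rw [mul_div_assoc]
      simp only [Nat.cast_one, Nat.sub_self, pow_zero]
      linarith
  · rw [← rG_pow G h]
    have := hx m hm G h e
    have h0 : 0 ≤ rG G x e := by linarith
    gcongr
    exact this.2.le

lemma le_NGe_div {m a : ℕ} (p : ℝ) (hm : m ≤ a) (G : SimpleGraph (Fin m)) {τ : ℝ} (hτ : 0 < τ) :
    ∀ᶠ n : ℕ in atTop, ∀ δ : ℝ, 0 < p - δ → ∀ x : Config n, memT a p δ x → ∀ e : EdgeSet n,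
    2 * (numEdges G : ℝ) * (p - δ) ^ (numEdges G - 1) - τ ≤ NGe G x e / (n : ℝ) ^ (m - 2) := by
  have hlim : Tendsto (fun n : ℕ => (((n - 2).descFactorial (m - 2) : ℕ) : ℝ) / (n : ℝ) ^ (m - 2))
      atTop (𝓝 1) := by
    have h1 := (Asymptotics.isEquivalent_iff_tendsto_one (by
      filter_upwards [eventually_gt_atTop 0] with n hn
      positivity)).1 (isEquivalent_descFactorial (m - 2))
    have h2 := h1.comp (tendsto_sub_atTop_nat 2)
    have h3 : Tendsto (fun n : ℕ => (((n - 2 : ℕ) : ℝ) / n) ^ (m - 2)) atTop (𝓝 1) := by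
      have h4 : Tendsto (fun n : ℕ => 1 - (2 : ℝ) / n) atTop (𝓝 (1 - 0)) :=
        tendsto_const_nhds.sub (tendsto_const_div_atTop_nhds_zero_nat 2)
      have h5 := h4.pow (m - 2)
      simp only [sub_zero, one_pow] at h5
      refine h5.congr' ?_
      filter_upwards [eventually_ge_atTop 2] with n hn
      have : (n : ℝ) ≠ 0 := by norm_cast; omega
      rw [Nat.cast_sub hn]
      field_simp
      simp
    have h6 := h2.mul h3
    rw [one_mul] at h6
    refine h6.congr' ?_
    filter_upwards [eventually_gt_atTop 2] with n hn
    have : ((n - 2 : ℕ) : ℝ) ≠ 0 := by norm_cast; omega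
    simp only [Function.comp_apply, Pi.div_apply, div_pow]
    field_simp
  have hev := hlim.eventually (lt_mem_nhds (show 1 - τ / 2 < 1 by linarith))
  filter_upwards [hev] with n hn δ hδ x hx e
  rcases Nat.lt_or_ge (numEdges G) 2 with h | h
  · interval_cases hG : numEdges G
    · rw [NGe_of_numEdges_eq_zero G hG]; simp [hτ.le]
    · rw [NGe_of_numEdges_eq_one G hG, mul_div_assoc]
      simp only [Nat.cast_one, Nat.sub_self, pow_zero]
      linarith
  · rw [← rG_pow G h]
    have := hx m hm G h e
    have h3 : (p - δ) ^ (numEdges G - 1) ≤ rG G x e ^ (numEdges G - 1) :=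
      pow_le_pow_left₀ hδ.le this.1.le _
    have h4 : (0 : ℝ) ≤ 2 * (numEdges G : ℝ) := by positivity
    have := mul_le_mul_of_nonneg_left h3 h4
    linarith

/-- The formal derivative of `Psi`. -/
noncomputable def Psi' {s : ℕ} (V : Fin s → ℕ) (G : ∀ i, SimpleGraph (Fin (V i)))
    (β : Fin s → ℝ) (p : ℝ) : ℝ :=
  ∑ i, β i * (numEdges (G i) * (2 * ((numEdges (G i) - 1 : ℕ) : ℝ) * p ^ (numEdges (G i) - 2)))

lemma hasDerivAt_Psi {s : ℕ} (V : Fin s → ℕ) (G : ∀ i, SimpleGraph (Fin (V i)))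
    (β : Fin s → ℝ) (p : ℝ) : HasDerivAt (Psi V G β) (Psi' V G β p) p := by
  have : Psi V G β = fun p =>
    ∑ i, 2 * β i * (numEdges (G i) : ℝ) * p ^ (numEdges (G i) - 1) := rfl
  rw [this]
  unfold Psi'
  refine HasDerivAt.fun_sum fun i _ => ?_
  refine ((hasDerivAt_pow (numEdges (G i) - 1) p).const_mul
    (2 * β i * (numEdges (G i) : ℝ))).congr_deriv ?_
  rw [Nat.sub_sub]
  ring

lemma continuous_Psi' {s : ℕ} (V : Fin s → ℕ) (G : ∀ i, SimpleGraph (Fin (V i)))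
    (β : Fin s → ℝ) : Continuous (Psi' V G β) := by
  unfold Psi'
  fun_prop

lemma contDiff_Phi : ContDiff ℝ 1 Phi := by
  unfold Phi
  refine Real.contDiff_exp.div (contDiff_const.add Real.contDiff_exp) fun x => ?_
  positivity

lemma Phi_pos (u : ℝ) : 0 < Phi u := by
  unfold Phi; positivity

lemma Phi_lt_one (u : ℝ) : Phi u < 1 := by
  unfold Phi
  rw [div_lt_one (by positivity)]
  linarith

lemma Phi_mono : Monotone Phi := by
  intro u v h
  unfold Phi
  rw [div_le_div_iff₀ (by positivity) (by positivity)]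
  have := Real.exp_le_exp.2 h
  nlinarith

/-- The total normalized count of embeddings through a fixed edge and a second edge. -/
lemma sum_NGee_div_le {n m a : ℕ} {p δ : ℝ} (hδ : 0 < p - δ) {x : Config n} (hx : memT a p δ x)
    (hm : m ≤ a) (G : SimpleGraph (Fin m)) (f : EdgeSet n) :
    ∑ e : EdgeSet n, (if f ≠ e then NGee G x e f / (n : ℝ) ^ (m - 2) else 0) ≤
      numEdges G * (2 * ((numEdges G - 1 : ℕ) : ℝ) * (p + δ) ^ (numEdges G - 2)) := by
  classical
  have h1 : ∑ e : EdgeSet n, (if f ≠ e then NGee G x e f / (n : ℝ) ^ (m - 2) else 0) =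
      (∑ e : EdgeSet n, (if f ≠ e then NGee G x e f else 0)) / (n : ℝ) ^ (m - 2) := by
    rw [Finset.sum_div]
    exact Finset.sum_congr rfl fun e _ => by split_ifs <;> simp
  rw [h1]
  have h2 := sum_NGee_le G x f
  have h3 : (0 : ℝ) ≤ (n : ℝ) ^ (m - 2) := by positivity
  have h4 : (∑ e : EdgeSet n, (if f ≠ e then NGee G x e f else 0)) / (n : ℝ) ^ (m - 2) ≤
      (∑ d ∈ G.edgeFinset, NGe (G.deleteEdges {d}) x f) / (n : ℝ) ^ (m - 2) :=
    div_le_div_of_nonneg_right h2 h3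
  refine h4.trans ?_
  rw [Finset.sum_div, ← card_edgeFinset_eq_numEdges, ← nsmul_eq_mul]
  refine Finset.sum_le_card_nsmul _ _ _ fun d hd => ?_
  have := NGe_div_le hδ hx hm (G.deleteEdges {d}) f
  rwa [numEdges_deleteEdges G (by simpa using hd), Nat.sub_sub,
    ← card_edgeFinset_eq_numEdges] at this

lemma seed_ne_le {n s : ℕ} (V : Fin s → ℕ) (G : ∀ i, SimpleGraph (Fin (V i)))
    (β : Fin s → ℝ) (y z : Config n) (e : EdgeSet n)
    (h : Phi (dHam V G β e y) ≤ Phi (dHam V G β e z)) :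
    ((seed n) {ω : EdgeSet n × ℝ | gcStep V G β ω y e ≠ gcStep V G β ω z e}).toReal ≤
      (1 - 1 / (Fintype.card (EdgeSet n) : ℝ)) * (if y e = z e then 0 else 1) +
      1 / (Fintype.card (EdgeSet n) : ℝ) * (Phi (dHam V G β e z) - Phi (dHam V G β e y)) := by
  classical
  have hMpos : 0 < Fintype.card (EdgeSet n) := Fintype.card_pos_iff.2 ⟨e⟩
  set M := Fintype.card (EdgeSet n) with hM
  set A : Set (EdgeSet n) := if y e = z e then ∅ else ((Finset.univ.erase e : Finset (EdgeSet n)) : Set _)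
    with hA
  have hsub : {ω : EdgeSet n × ℝ | gcStep V G β ω y e ≠ gcStep V G β ω z e} ⊆
      A ×ˢ Set.univ ∪
      ((({e} : Finset (EdgeSet n)) : Set (EdgeSet n)) ×ˢ
        Set.Ioc (Phi (dHam V G β e y)) (Phi (dHam V G β e z))) := by
    rintro ⟨I, U⟩ hω
    simp only [Set.mem_ofPred_eq, gcStep] at hω
    by_cases hI : I = e
    · right
      subst hI
      simp only [Function.update_self] at hω
      simp only [Finset.coe_singleton, Set.mem_prod, Set.mem_singleton_iff, true_and, Set.mem_Ioc]
      by_cases h1 : U ≤ Phi (dHam V G β I y)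
      · rw [if_pos h1, if_pos (h1.trans h)] at hω
        exact absurd rfl hω
      · by_cases h2 : U ≤ Phi (dHam V G β I z)
        · exact ⟨not_le.1 h1, h2⟩
        · rw [if_neg h1, if_neg h2] at hω
          exact absurd rfl hω
    · left
      have hI' : e ≠ I := Ne.symm hI
      rw [Function.update_of_ne hI', Function.update_of_ne hI'] at hω
      simp only [Set.mem_prod, Set.mem_univ, and_true, hA, if_neg hω]
      simp [hI]
  have hcount : ∀ S : Finset (EdgeSet n),
      (((M : ℝ≥0∞)⁻¹ • (Measure.count : Measure (EdgeSet n))) (S : Set (EdgeSet n))).toReal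
        = (S.card : ℝ) / M := by
    intro S
    rw [Measure.smul_apply, Measure.count_apply_finset' MeasurableSpace.measurableSet_top]
    simp [div_eq_inv_mul]
  have hfin : ∀ S : Finset (EdgeSet n),
      ((M : ℝ≥0∞)⁻¹ • (Measure.count : Measure (EdgeSet n))) (S : Set (EdgeSet n)) ≠ ∞ := by
    intro S
    rw [Measure.smul_apply, Measure.count_apply_finset' MeasurableSpace.measurableSet_top]
    refine ENNReal.mul_ne_top ?_ (by simp)
    simp [hMpos.ne']
  have hAr : (seed n (A ×ˢ Set.univ)).toReal =
      (1 - 1 / (M : ℝ)) * (if y e = z e then 0 else 1) ∧ seed n (A ×ˢ Set.univ) ≠ ∞ := by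
    rw [seed, Measure.prod_prod]
    have hu : (volume.restrict (Set.Ioc (0 : ℝ) 1)) Set.univ = 1 := by simp
    rw [hu, mul_one, hA]
    split_ifs with hyz
    · simp
    · refine ⟨?_, hfin _⟩
      rw [← hM, hcount, Finset.card_erase_of_mem (Finset.mem_univ e), Finset.card_univ, ← hM,
        Nat.cast_sub (by omega)]
      have : (M : ℝ) ≠ 0 := by norm_cast; omega
      field_simp
      simp
  have hBr : (seed n ((({e} : Finset (EdgeSet n)) : Set (EdgeSet n)) ×ˢ
        Set.Ioc (Phi (dHam V G β e y)) (Phi (dHam V G β e z)))).toReal =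
      1 / (M : ℝ) * (Phi (dHam V G β e z) - Phi (dHam V G β e y)) ∧
      seed n ((({e} : Finset (EdgeSet n)) : Set (EdgeSet n)) ×ˢ
        Set.Ioc (Phi (dHam V G β e y)) (Phi (dHam V G β e z))) ≠ ∞ := by
    have hv : (volume.restrict (Set.Ioc (0 : ℝ) 1))
        (Set.Ioc (Phi (dHam V G β e y)) (Phi (dHam V G β e z))) =
        ENNReal.ofReal (Phi (dHam V G β e z) - Phi (dHam V G β e y)) := by
      rw [Measure.restrict_apply measurableSet_Ioc, Set.inter_eq_left.2, Real.volume_Ioc]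
      exact Set.Ioc_subset_Ioc (Phi_pos _).le (Phi_lt_one _).le
    rw [seed, Measure.prod_prod, hv]
    refine ⟨?_, ENNReal.mul_ne_top (hfin _) ENNReal.ofReal_ne_top⟩
    rw [ENNReal.toReal_mul, ← hM, hcount, ENNReal.toReal_ofReal (by linarith)]
    simp
  rw [← hAr.1, ← hBr.1, ← ENNReal.toReal_add hAr.2 hBr.2]
  exact ENNReal.toReal_mono (ENNReal.add_ne_top.2 ⟨hAr.2, hBr.2⟩)
    ((measure_mono hsub).trans (measure_union_le _ _))

/-- **(Proposition 4.3: one-step contraction matrix on `T_δ`).** -/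
theorem contraction_matrix_on_T {s : ℕ} (V : Fin s → ℕ) (G : ∀ i, SimpleGraph (Fin (V i)))
    (β : Fin s → ℝ) (hβ : ∀ i, 0 < β i) (p : ℝ) (hsub : Subcritical V G β p)
    (a : ℕ) (ha : ∀ i, V i ≤ a) :
    ∃ δ : ℝ, 0 < δ ∧ ∃ N : ℕ, ∀ n : ℕ, N ≤ n →
      ∀ y z : Config n, (∀ e, y e ≤ z e) → memT a p δ y → memT a p δ z →
        ∃ K : EdgeSet n → EdgeSet n → ℝ,
          (∀ e f, 0 ≤ K e f) ∧
          (∀ f : EdgeSet n,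
            ∑ e : EdgeSet n, K e f < 1 - δ / (Fintype.card (EdgeSet n) : ℝ)) ∧
          ∀ e : EdgeSet n,
            ((seed n) {ω : EdgeSet n × ℝ |
                gcStep V G β ω y e ≠ gcStep V G β ω z e}).toReal ≤
              ∑ f : EdgeSet n, K e f * (if y f = z f then 0 else 1) := by
  classical
  set L := deriv Phi (Psi V G β p) with hL
  have hΦ : HasStrictDerivAt Phi L (Psi V G β p) :=
    contDiff_Phi.contDiffAt.hasStrictDerivAt one_ne_zero
  have hL0 : 0 ≤ L := Phi_mono.deriv_nonneg
  have hp : 0 < p := by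
    rw [← hsub.1]
    exact Phi_pos _
  have hLD : L * Psi' V G β p < 1 := by
    have h1 : HasDerivAt (phiFn V G β) (L * Psi' V G β p) p :=
      hΦ.hasDerivAt.comp p (hasDerivAt_Psi V G β p)
    rw [← h1.deriv]
    exact hsub.2.2
  obtain ⟨c, hLc, hcD⟩ : ∃ c : ℝ, L < c ∧ c * Psi' V G β p < 1 := by
    have h1 : Tendsto (fun c : ℝ => c * Psi' V G β p) (𝓝[>] L) (𝓝 (L * Psi' V G β p)) :=
      ((continuous_id.mul continuous_const).tendsto L).mono_left nhdsWithin_le_nhds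
    obtain ⟨c, hc1, hc2⟩ := ((h1.eventually (gt_mem_nhds hLD)).and self_mem_nhdsWithin).exists
    exact ⟨c, hc2, hc1⟩
  have hc0 : 0 ≤ c := hL0.trans hLc.le
  obtain ⟨η, hη, hlip⟩ : ∃ η : ℝ, 0 < η ∧ ∀ u v : ℝ, |u - Psi V G β p| < η →
      |v - Psi V G β p| < η → Phi v - Phi u ≤ c * |v - u| := by
    obtain ⟨S, hS, hK⟩ := hΦ.hasStrictFDerivAt.exists_lipschitzOnWith_of_nnnorm_lt c.toNNReal (by
      rw [← NNReal.coe_lt_coe, Real.coe_toNNReal c hc0]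
      simpa [abs_of_nonneg hL0] using hLc)
    obtain ⟨η, hη, hball⟩ := Metric.mem_nhds_iff.1 hS
    refine ⟨η, hη, fun u v hu hv => ?_⟩
    have := hK.dist_le_mul v (hball (by simpa [Real.dist_eq] using hv)) u
      (hball (by simpa [Real.dist_eq] using hu))
    rw [Real.dist_eq, Real.dist_eq, Real.coe_toNNReal c hc0] at this
    exact (le_abs_self _).trans this
  have hΨc : Continuous (Psi V G β) :=
    continuous_iff_continuousAt.2 fun q => (hasDerivAt_Psi V G β q).continuousAt
  obtain ⟨δ, hδ, hδp, hδD, hup, hlow⟩ : ∃ δ : ℝ, 0 < δ ∧ δ < p ∧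
      c * Psi' V G β (p + δ) + δ < 1 ∧ Psi V G β (p + δ) < Psi V G β p + η ∧
      Psi V G β p - η / 2 < Psi V G β (p - δ) := by
    have h1 : Tendsto (fun δ : ℝ => c * Psi' V G β (p + δ) + δ) (𝓝 0) (𝓝 (c * Psi' V G β p)) := by
      have h : Continuous (fun δ : ℝ => c * Psi' V G β (p + δ) + δ) :=
        (continuous_const.mul ((continuous_Psi' V G β).comp (continuous_const.add continuous_id))).add
          continuous_id
      simpa using h.tendsto 0
    have h2 : Tendsto (fun δ : ℝ => Psi V G β (p + δ)) (𝓝 0) (𝓝 (Psi V G β p)) := by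
      have h : Continuous (fun δ : ℝ => Psi V G β (p + δ)) :=
        hΨc.comp (continuous_const.add continuous_id)
      simpa using h.tendsto 0
    have h3 : Tendsto (fun δ : ℝ => Psi V G β (p - δ)) (𝓝 0) (𝓝 (Psi V G β p)) := by
      have h : Continuous (fun δ : ℝ => Psi V G β (p - δ)) :=
        hΨc.comp (continuous_const.sub continuous_id)
      simpa using h.tendsto 0
    have hev := ((h1.eventually (gt_mem_nhds hcD)).and
      ((h2.eventually (gt_mem_nhds (lt_add_of_pos_right _ hη))).and
        ((h3.eventually (lt_mem_nhds (sub_lt_self _ (half_pos hη)))).and (gt_mem_nhds hp))))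
    obtain ⟨δ, ⟨e1, e2, e3, e4⟩, h0⟩ :=
      ((hev.filter_mono nhdsWithin_le_nhds).and (self_mem_nhdsWithin (s := Set.Ioi (0 : ℝ)))).exists
    exact ⟨δ, h0, e4, e1, e2, e3⟩
  have hpδ : 0 < p - δ := sub_pos.2 hδp
  have hβ0 : 0 ≤ ∑ i, β i := Finset.sum_nonneg fun i _ => (hβ i).le
  set τ := η / (2 * (∑ i, β i + 1)) with hτdef
  have hτ : 0 < τ := by positivity
  have hτsum : (∑ i, β i) * τ ≤ η / 2 := by
    rw [hτdef, mul_div_assoc', div_le_div_iff₀ (by positivity) (by positivity)]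
    nlinarith
  obtain ⟨N, hN⟩ := eventually_atTop.1
    (eventually_all.2 fun i => le_NGe_div (m := V i) p (ha i) (G i) hτ)
  refine ⟨δ, hδ, N, fun n hn y z hyz hy hz => ?_⟩
  have hrange : ∀ x : Config n, memT a p δ x → ∀ e,
      |dHam V G β e x - Psi V G β p| < η := by
    intro x hx e
    have hle : dHam V G β e x ≤ Psi V G β (p + δ) := by
      rw [dHam_eq, Psi]
      refine Finset.sum_le_sum fun i _ => ?_
      have := mul_le_mul_of_nonneg_left (NGe_div_le hpδ hx (ha i) (G i) e) (hβ i).le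
      linarith
    have hge : Psi V G β (p - δ) - (∑ i, β i) * τ ≤ dHam V G β e x := by
      rw [dHam_eq, Psi, Finset.sum_mul, ← Finset.sum_sub_distrib]
      refine Finset.sum_le_sum fun i _ => ?_
      have := mul_le_mul_of_nonneg_left (hN n hn i δ hpδ x hx e) (hβ i).le
      linarith
    rw [abs_lt]
    constructor <;> linarith
  set M : ℝ := (Fintype.card (EdgeSet n) : ℝ) with hM
  let W : EdgeSet n → EdgeSet n → ℝ := fun e f =>
    ∑ i, β i * (if f ≠ e then NGee (G i) z e f / (n : ℝ) ^ (V i - 2) else 0)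
  have hW0 : ∀ e f, 0 ≤ W e f := by
    intro e f
    refine Finset.sum_nonneg fun i _ => mul_nonneg (hβ i).le ?_
    split_ifs
    · exact div_nonneg (NGee_nonneg _ _ _ _) (by positivity)
    · rfl
  have hWsum : ∀ f, ∑ e, W e f ≤ Psi' V G β (p + δ) := by
    intro f
    rw [Finset.sum_comm, Psi']
    refine Finset.sum_le_sum fun i _ => ?_
    rw [← Finset.mul_sum]
    exact mul_le_mul_of_nonneg_left (sum_NGee_div_le hpδ hz (ha i) (G i) f) (hβ i).le
  have hdiff : ∀ e, dHam V G β e z - dHam V G β e y ≤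
      ∑ f, W e f * (if y f = z f then 0 else 1) := by
    intro e
    simp only [W, Finset.sum_mul]
    rw [dHam_eq, dHam_eq, ← Finset.sum_sub_distrib, Finset.sum_comm]
    refine Finset.sum_le_sum fun i _ => ?_
    have h1 := div_le_div_of_nonneg_right (NGe_sub_le (G i) y z e)
      (show (0 : ℝ) ≤ (n : ℝ) ^ (V i - 2) by positivity)
    have h2 := mul_le_mul_of_nonneg_left h1 (hβ i).le
    rw [Finset.sum_div, Finset.mul_sum, sub_div, mul_sub] at h2
    refine h2.trans (le_of_eq (Finset.sum_congr rfl fun f _ => ?_))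
    by_cases hfe : f = e <;> by_cases hyf : y f = z f <;> simp [hfe, hyf]
  have hMpos : EdgeSet n → 1 ≤ M := fun e => by
    rw [hM]
    exact_mod_cast Nat.succ_le_of_lt (Fintype.card_pos_iff.2 ⟨e⟩)
  refine ⟨fun e f => (1 - 1 / M) * (if e = f then 1 else 0) + 1 / M * (c * W e f), ?_, ?_, ?_⟩
  · intro e f
    have h1 : 1 / M ≤ 1 := div_le_one_of_le₀ (hMpos e) (zero_le_one.trans (hMpos e))
    have h2 : 0 ≤ 1 / M := one_div_nonneg.2 (zero_le_one.trans (hMpos e))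
    refine add_nonneg (mul_nonneg (sub_nonneg.2 h1) ?_) (mul_nonneg h2 (mul_nonneg hc0 (hW0 e f)))
    split_ifs <;> norm_num
  · intro f
    have hM0 : 0 < M := zero_lt_one.trans_le (hMpos f)
    rw [Finset.sum_add_distrib, ← Finset.mul_sum, ← Finset.mul_sum, ← Finset.mul_sum]
    have h1 : c * ∑ e, W e f < 1 - δ := by
      have := mul_le_mul_of_nonneg_left (hWsum f) hc0
      linarith
    have h2 := mul_lt_mul_of_pos_left h1 (one_div_pos.2 hM0)
    have h3 : δ / M = 1 / M * δ := by ring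
    rw [Finset.sum_ite_eq' Finset.univ f, if_pos (Finset.mem_univ f), h3]
    linarith
  · intro e
    have hmono : dHam V G β e y ≤ dHam V G β e z := by
      rw [dHam_eq, dHam_eq]
      refine Finset.sum_le_sum fun i _ => mul_le_mul_of_nonneg_left ?_ (hβ i).le
      exact div_le_div_of_nonneg_right (NGe_mono (G i) hyz e) (by positivity)
    refine (seed_ne_le V G β y z e (Phi_mono hmono)).trans ?_
    have h1 := hlip _ _ (hrange y hy e) (hrange z hz e)
    rw [abs_of_nonneg (sub_nonneg.2 hmono)] at h1
    have h2 := h1.trans (mul_le_mul_of_nonneg_left (hdiff e) hc0)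
    have h3 : 0 ≤ 1 / M := one_div_nonneg.2 (zero_le_one.trans (hMpos e))
    have h4 := mul_le_mul_of_nonneg_left h2 h3
    have h5 : ∑ f, ((1 - 1 / M) * (if e = f then 1 else 0) + 1 / M * (c * W e f)) *
        (if y f = z f then (0 : ℝ) else 1) = (1 - 1 / M) * (if y e = z e then 0 else 1) +
        1 / M * (c * ∑ f, W e f * (if y f = z f then 0 else 1)) := by
      simp only [add_mul, Finset.sum_add_distrib, Finset.mul_sum]
      congr 1
      · rw [Finset.sum_eq_single e]
        · simp
        · intro f _ hf
          simp [hf.symm]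
        · simp
      · exact Finset.sum_congr rfl fun f _ => by ring
    rw [h5]
    linarith

end ERGM
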